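/- Let π = {C₁, C₂, C₃, …, C_K} be a K-partition of V with |C₁| ≥ 2, let r₁ and r₂ be the smallest elements of C₁ and C₂ with r₁ < r₂, let r′₁ be the second-smallest element of C₁, and let c₂ ∈ C₂ ∖ {r₂}. Let π¹, π², π³ be the K-partitions obtained from π by applying the transformations T(C₁,C₂,{r₁}), T(C₁,C₂,{c₂}), and T(C₁,C₂,{r₁,c₂}) respectively. If α ∈ ℝ^{|E|+n−3} and α₀ ∈ ℝ are such that the characteristic vectors of π, π¹, π², π³ all satisfy α·x = α₀, then 2·α_{r₁,c₂} + α_{r′₁} = α_{min(r′₁,c₂)} (with the convention α_v = 0 for v ∈ {1,2,3}). -/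

import Mathlib

/-- A `K`-partition of `V = {1,…,n}`: a family of `K` nonempty pairwise disjoint
subsets of `V` (clusters) whose union is `V`. -/
structure KPartition (n K : ℕ) where
  parts : Finset (Finset ℕ)
  card_parts : parts.card = K
  parts_nonempty : ∀ C ∈ parts, C.Nonempty
  parts_disjoint : ∀ C ∈ parts, ∀ D ∈ parts, C ≠ D → Disjoint C D
  parts_cover : parts.sup id = Finset.Icc 1 n

/-- The ambient space: one (symmetric) edge coordinate for each pair of vertices and one
representative coordinate for each vertex (only the coordinates of edges `uv ∈ E` and of
vertices `v ∈ {4,…,n}` are actually used; the remaining ones are affinely determined, so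
affine dimensions agree with those in `ℝ^{|E|+n-3}`). -/
abbrev GPoint : Type := (ℕ × ℕ → ℝ) × (ℕ → ℝ)

open Classical in
/-- The characteristic vector of a `K`-partition: edge component `x_{u,v} = 1` iff `u` and `v`
lie in the same cluster; representative component `x_v = 1` (for `v ∈ {4,…,n}`) iff `v` is the
smallest element of its cluster. -/
noncomputable def charVec (n K : ℕ) (π : KPartition n K) : GPoint :=
  ⟨fun p => if ∃ C ∈ π.parts, p.1 ∈ C ∧ p.2 ∈ C then 1 else 0,
   fun v => if 4 ≤ v ∧ ∃ C ∈ π.parts, v ∈ C ∧ ∀ w ∈ C, v ≤ w then 1 else 0⟩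

/-- `P_{n,K}`: the convex hull of the characteristic vectors of all `K`-partitions. -/
noncomputable def PolyP (n K : ℕ) : Set GPoint :=
  convexHull ℝ {x | ∃ π : KPartition n K, x = charVec n K π}

/-- Affine dimension of a set: the rank of the direction of its affine span. -/
noncomputable def adim (s : Set GPoint) : ℕ :=
  Module.finrank ℝ (affineSpan ℝ s).direction

/-- `f x ≤ b` is a valid inequality for `P_{n,K}` which is facet-defining. -/
def IsFacetLe (n K : ℕ) (f : GPoint → ℝ) (b : ℝ) : Prop :=
  (∀ x ∈ PolyP n K, f x ≤ b) ∧
  adim {x | x ∈ PolyP n K ∧ f x = b} + 1 = adim (PolyP n K)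

/-- `f x ≥ b` is a valid inequality for `P_{n,K}` which is facet-defining. -/
def IsFacetGe (n K : ℕ) (f : GPoint → ℝ) (b : ℝ) : Prop :=
  (∀ x ∈ PolyP n K, b ≤ f x) ∧
  adim {x | x ∈ PolyP n K ∧ f x = b} + 1 = adim (PolyP n K)

/-- Sum of the edge components of `x` over the edges with both endpoints in `A`. -/
noncomputable def edgeSum (A : Finset ℕ) (x : GPoint) : ℝ :=
  ∑ e ∈ A.offDiag.filter (fun e => e.1 < e.2), x.1 e

/-- The transformation `T(C₁,C₂,R)` on the clusters of a partition: the elements of `R`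
switch between `C₁` and `C₂`, all other clusters are unchanged. -/
def swapParts (parts : Finset (Finset ℕ)) (C₁ C₂ R : Finset ℕ) : Finset (Finset ℕ) :=
  insert ((C₁ \ R) ∪ (R ∩ C₂)) (insert ((C₂ \ R) ∪ (R ∩ C₁)) (parts \ {C₁, C₂}))

/-- The pairing `α·x = Σ_{uv ∈ E} α_{u,v} x_{u,v} + Σ_{v=4}^n α_v x_v`. -/
noncomputable def dotP (n : ℕ) (a x : GPoint) : ℝ :=
  (∑ e ∈ (Finset.Icc 1 n).offDiag.filter (fun e => e.1 < e.2), a.1 e * x.1 e) +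
    ∑ v ∈ Finset.Icc 4 n, a.2 v * x.2 v

/-- The representative coefficient `α_v`, with the convention `α_v = 0` for `v ∈ {1,2,3}`. -/
noncomputable def repCoef (a : GPoint) (v : ℕ) : ℝ :=
  if 4 ≤ v then a.2 v else 0

/-- Clusters of a partition consist of vertices. -/
theorem KPartition.mem_Icc {n K : ℕ} (π : KPartition n K) {C : Finset ℕ} (hC : C ∈ π.parts)
    {v : ℕ} (hv : v ∈ C) : v ∈ Finset.Icc 1 n := by
  rw [← π.parts_cover]
  exact Finset.le_sup (f := id) hC hv

theorem KPartition.eq_of_mem {n K : ℕ} (π : KPartition n K) {C D : Finset ℕ}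
    (hC : C ∈ π.parts) (hD : D ∈ π.parts) {v : ℕ} (hvC : v ∈ C) (hvD : v ∈ D) : C = D := by
  by_contra h
  exact Finset.disjoint_left.1 (π.parts_disjoint C hC D hD h) hvC hvD

theorem exists_mem_swapParts (S : Finset (Finset ℕ)) (C₁ C₂ R : Finset ℕ)
    (P : Finset ℕ → Prop) :
    (∃ C ∈ swapParts S C₁ C₂ R, P C) ↔
      P ((C₁ \ R) ∪ (R ∩ C₂)) ∨ P ((C₂ \ R) ∪ (R ∩ C₁)) ∨ ∃ C ∈ S \ {C₁, C₂}, P C := by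
  simp only [swapParts, Finset.exists_mem_insert]

theorem exists_mem_iff_of_two_mem {S : Finset (Finset ℕ)} {C₁ C₂ : Finset ℕ} (h₁ : C₁ ∈ S)
    (h₂ : C₂ ∈ S) (P : Finset ℕ → Prop) :
    (∃ C ∈ S, P C) ↔ P C₁ ∨ P C₂ ∨ ∃ C ∈ S \ {C₁, C₂}, P C := by
  have hS : S = insert C₁ (insert C₂ (S \ {C₁, C₂})) := by grind
  conv_lhs => rw [hS]
  simp only [Finset.exists_mem_insert]

/-- The pairing `α·x` depends linearly on `x`; this is the form needed for the alternating sum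
of four points. -/
theorem dotP_alternating (n : ℕ) (a x x₁ x₂ x₃ : GPoint) :
    dotP n a x + dotP n a x₃ - dotP n a x₁ - dotP n a x₂ =
      (∑ e ∈ (Finset.Icc 1 n).offDiag.filter (fun e => e.1 < e.2),
          a.1 e * (x.1 e + x₃.1 e - x₁.1 e - x₂.1 e)) +
        ∑ v ∈ Finset.Icc 4 n, a.2 v * (x.2 v + x₃.2 v - x₁.2 v - x₂.2 v) := by
  simp only [dotP, mul_sub, mul_add, Finset.sum_sub_distrib, Finset.sum_add_distrib]
  ring

/-- Picking out the coefficient of the edge `uv` from the sum over all edges. -/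
theorem sum_edges_ite {n u v : ℕ} (hu : u ∈ Finset.Icc 1 n) (hv : v ∈ Finset.Icc 1 n)
    (huv : u ≠ v) (a : ℕ × ℕ → ℝ) (hsym : ∀ u v, a (u, v) = a (v, u)) (c : ℝ) :
    (∑ e ∈ (Finset.Icc 1 n).offDiag.filter (fun e => e.1 < e.2),
      a e * (if e = (u, v) ∨ e = (v, u) then c else 0)) = c * a (u, v) := by
  wlog h : u < v generalizing u v
  · rw [hsym u v, ← this hv hu huv.symm (by omega)]
    simp only [or_comm]
  rw [Finset.sum_eq_single_of_mem (u, v)]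
  · simp [mul_comm]
  · simpa [huv, h] using ⟨Finset.mem_Icc.1 hu, Finset.mem_Icc.1 hv⟩
  · rintro ⟨x, y⟩ he hne
    simp only [Finset.mem_filter] at he
    have : ¬((x, y) = (u, v) ∨ (x, y) = (v, u)) := by
      rintro (h' | h')
      · exact hne h'
      · simp only [Prod.mk.injEq] at h'
        omega
    rw [if_neg this, mul_zero]

/-- Picking out a representative coefficient. -/
theorem sum_reps_ite {n r : ℕ} (hr : r ∈ Finset.Icc 1 n) (a : GPoint) :
    (∑ v ∈ Finset.Icc 4 n, a.2 v * (if v = r then 1 else 0)) = repCoef a r := by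
  have := (Finset.mem_Icc.1 hr).2
  simp [repCoef, this]

/-- Lemma 2: with `|C₁| ≥ 2`, `r₁ < r₂`, `r₁'` the second-smallest element of `C₁` and
`c₂ ∈ C₂ ∖ {r₂}`, if the characteristic vectors of `π` and of the partitions obtained by
`T(C₁,C₂,{r₁})`, `T(C₁,C₂,{c₂})`, `T(C₁,C₂,{r₁,c₂})` all lie on the hyperplane
`α·x = α₀`, then `2α_{r₁,c₂} + α_{r₁'} = α_{min(r₁',c₂)}`. -/
theorem lemma2 (n K : ℕ) (π π₁ π₂ π₃ : KPartition n K)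
    (C₁ C₂ : Finset ℕ) (hC₁ : C₁ ∈ π.parts) (hC₂ : C₂ ∈ π.parts) (hCne : C₁ ≠ C₂)
    (hC₁card : 2 ≤ C₁.card)
    (r₁ r₂ r₁' c₂ : ℕ)
    (hr₁ : r₁ ∈ C₁) (hr₁min : ∀ w ∈ C₁, r₁ ≤ w)
    (hr₂ : r₂ ∈ C₂) (hr₂min : ∀ w ∈ C₂, r₂ ≤ w)
    (hr₁₂ : r₁ < r₂)
    (hr₁' : r₁' ∈ C₁) (hr₁'ne : r₁' ≠ r₁) (hr₁'min : ∀ w ∈ C₁, w ≠ r₁ → r₁' ≤ w)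
    (hc₂ : c₂ ∈ C₂) (hc₂ne : c₂ ≠ r₂)
    (h₁ : π₁.parts = swapParts π.parts C₁ C₂ {r₁})
    (h₂ : π₂.parts = swapParts π.parts C₁ C₂ {c₂})
    (h₃ : π₃.parts = swapParts π.parts C₁ C₂ {r₁, c₂})
    (a : GPoint) (hsym : ∀ u v, a.1 (u, v) = a.1 (v, u)) (a₀ : ℝ)
    (hπ : dotP n a (charVec n K π) = a₀)
    (hπ₁ : dotP n a (charVec n K π₁) = a₀)
    (hπ₂ : dotP n a (charVec n K π₂) = a₀)
    (hπ₃ : dotP n a (charVec n K π₃) = a₀) :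
    2 * a.1 (r₁, c₂) + repCoef a r₁' = repCoef a (min r₁' c₂) := by
  have hd : ∀ v, v ∈ C₁ → v ∉ C₂ := fun v h h' => hCne (π.eq_of_mem hC₁ hC₂ h h')
  have hrest : ∀ C ∈ π.parts \ {C₁, C₂}, ∀ v ∈ C, v ∉ C₁ ∧ v ∉ C₂ := by
    intro C hC v hv
    simp only [Finset.mem_sdiff, Finset.mem_insert, Finset.mem_singleton, not_or] at hC
    exact ⟨fun h => hC.2.1 (π.eq_of_mem hC.1 hC₁ hv h),
      fun h => hC.2.2 (π.eq_of_mem hC.1 hC₂ hv h)⟩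
  have hne : r₁ ≠ c₂ := fun h => hd _ hr₁ (h ▸ hc₂)
  have hne' : r₁' ≠ c₂ := fun h => hd _ hr₁' (h ▸ hc₂)
  have hedge : ∀ e : ℕ × ℕ, e.1 < e.2 →
      (charVec n K π).1 e + (charVec n K π₃).1 e - (charVec n K π₁).1 e - (charVec n K π₂).1 e =
        if e = (r₁, c₂) ∨ e = (c₂, r₁) then -2 else 0 := by
    rintro ⟨u, v⟩ huv
    simp only [charVec, h₁, h₂, h₃, exists_mem_swapParts, exists_mem_iff_of_two_mem hC₁ hC₂,
      Prod.mk.injEq]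
    by_cases hQ : ∃ C ∈ π.parts \ {C₁, C₂}, u ∈ C ∧ v ∈ C
    · obtain ⟨C, hC, hu, hv⟩ := id hQ
      have hu' := hrest C hC u hu
      have hv' := hrest C hC v hv
      simp only [hQ, or_true, if_true]
      rw [if_neg (by grind)]
      norm_num
    · simp only [hQ, or_false]
      simp only [Finset.mem_union, Finset.mem_sdiff, Finset.mem_inter, Finset.mem_insert, Finset.mem_singleton]
      have hu := hd u
      have hv := hd v
      have hr := hd _ hr₁
      have hc : c₂ ∉ C₁ := fun h => hd _ h hc₂
      by_cases hur : u = r₁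
      · subst hur
        by_cases hvc : v = c₂
        · subst hvc
          norm_num [hr, hc, hr₁, hc₂, hne, huv.ne, huv.ne']
        · by_cases v ∈ C₁ <;> by_cases v ∈ C₂ <;>
            simp_all [huv.ne']
      · by_cases huc : u = c₂
        · subst huc
          by_cases hvr : v = r₁
          · subst hvr
            norm_num [hr, hc, hr₁, hc₂, huv.ne, huv.ne']
          · by_cases v ∈ C₁ <;> by_cases v ∈ C₂ <;>
              simp_all [huv.ne']
        · by_cases hvr : v = r₁
          · subst hvr
            simp [hur, huc, hr, hr₁, hne]
          · by_cases hvc : v = c₂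
            · subst hvc
              simp [hur, huc, hvr, hc, hc₂]
            · simp [hur, huc, hvr, hvc]
  have hrep : ∀ v, 4 ≤ v →
      (charVec n K π).2 v + (charVec n K π₃).2 v - (charVec n K π₁).2 v - (charVec n K π₂).2 v =
        (if v = min r₁' c₂ then 1 else 0) - (if v = r₁' then 1 else 0) := by
    intro v hv
    have isLeast_iff : ∀ {C : Finset ℕ} {r : ℕ}, r ∈ C → (∀ w ∈ C, r ≤ w) →
        ((v ∈ C ∧ ∀ w ∈ C, v ≤ w) ↔ v = r) := fun {C r} hr hmin =>
      ⟨fun h => le_antisymm (h.2 r hr) (hmin v h.1), fun h => h ▸ ⟨hr, hmin⟩⟩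
    simp only [charVec, h₁, h₂, h₃, exists_mem_swapParts, exists_mem_iff_of_two_mem hC₁ hC₂, hv,
      true_and]
    simp only [isLeast_iff hr₁ hr₁min, isLeast_iff hr₂ hr₂min,
      isLeast_iff (r := min r₁' c₂) (C := (C₁ \ {r₁, c₂}) ∪ ({r₁, c₂} ∩ C₂)) (by grind) (by grind),
      isLeast_iff (r := r₁) (C := (C₂ \ {r₁, c₂}) ∪ ({r₁, c₂} ∩ C₁)) (by grind) (by grind),
      isLeast_iff (r := r₁') (C := (C₁ \ {r₁}) ∪ ({r₁} ∩ C₂)) (by grind) (by grind),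
      isLeast_iff (r := r₁) (C := (C₂ \ {r₁}) ∪ ({r₁} ∩ C₁)) (by grind) (by grind),
      isLeast_iff (r := r₁) (C := (C₁ \ {c₂}) ∪ ({c₂} ∩ C₂)) (by grind) (by grind),
      isLeast_iff (r := r₂) (C := (C₂ \ {c₂}) ∪ ({c₂} ∩ C₁)) (by grind) (by grind)]
    by_cases hQ : ∃ C ∈ π.parts \ {C₁, C₂}, v ∈ C ∧ ∀ w ∈ C, v ≤ w
    · obtain ⟨C, hC, hvC, -⟩ := id hQ
      have hv' := hrest C hC v hvC
      simp only [hQ, or_true, if_true]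
      rw [if_neg (by grind), if_neg (by grind)]
      norm_num
    · simp only [hQ, or_false]
      have : r₁ ≠ min r₁' c₂ := by grind
      by_cases h : v = r₁
      · subst h
        simp [this, hr₁'ne.symm]
      · simp only [h, false_or, or_false]
        ring
  have key := dotP_alternating n a (charVec n K π) (charVec n K π₁) (charVec n K π₂)
    (charVec n K π₃)
  have hr₁'V := π.mem_Icc hC₁ hr₁'
  have hc₂V := π.mem_Icc hC₂ hc₂
  have hminV : min r₁' c₂ ∈ Finset.Icc 1 n := by
    rcases min_choice r₁' c₂ with h | h <;> rw [h] <;> assumption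
  rw [Finset.sum_congr rfl fun e he => by rw [hedge e (Finset.mem_filter.1 he).2],
    Finset.sum_congr (s₁ := Finset.Icc 4 n) rfl fun v hv => by
      rw [hrep v (Finset.mem_Icc.1 hv).1, mul_sub],
    Finset.sum_sub_distrib, sum_reps_ite hminV, sum_reps_ite hr₁'V,
    sum_edges_ite (π.mem_Icc hC₁ hr₁) hc₂V hne a.1 hsym, hπ, hπ₁, hπ₂, hπ₃] at key
  linarith
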